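/- arXiv:1608.04373 — 2 statements merged into one kernel-verified Lean document; each statement's English description precedes it below -/
import Mathlib

section
/- Let G ⊆ G′ be two groups acting on a lattice M by isometries (the G-action being the restriction of the G′-action), and suppose their coinvariant sublattices coincide: (M^G)^⊥ = (M^{G′})^⊥ =: S. Then for all α_1, …, α_t ∈ M the primitive closures coincide: [S ∪ G·α_1 ∪ … ∪ G·α_t]_pr = [S ∪ G′·α_1 ∪ … ∪ G′·α_t]_pr. (In particular a group and its closure, having the same coinvariant lattice, determine the same sublattice S of a degeneration.) -/
/-- The invariant sublattice `M^G` of a `G`-action. -/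
def invariantSublattice {M G : Type*} [AddCommGroup M] [Group G]
    (ρ : G →* M ≃ₗ[ℤ] M) : Submodule ℤ M where
  carrier := {x | ∀ g : G, ρ g x = x}
  add_mem' := fun ha hb g => by rw [map_add, ha g, hb g]
  zero_mem' := fun g => map_zero _
  smul_mem' := fun c x hx g => by rw [map_smul, hx g]

/-- The coinvariant sublattice `S_G = (M^G)^⊥`. -/
def coinvariantSublattice {M G : Type*} [AddCommGroup M] [Group G]
    (b : M →ₗ[ℤ] M →ₗ[ℤ] ℤ) (ρ : G →* M ≃ₗ[ℤ] M) : Submodule ℤ M where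
  carrier := {y | ∀ x ∈ invariantSublattice ρ, b y x = 0}
  add_mem' := fun ha hc x hx => by
    rw [map_add, LinearMap.add_apply, ha x hx, hc x hx, add_zero]
  zero_mem' := fun x _ => by rw [map_zero, LinearMap.zero_apply]
  smul_mem' := fun n y hy x hx => by
    rw [map_smul, LinearMap.smul_apply, hy x hx, smul_zero]

/-- The primitive closure `[A]_pr` of a subset `A ⊆ M`: all `m ∈ M` such that `n • m`
lies in the subgroup of `M` generated by `A` for some positive integer `n`. -/
def primClosure {M : Type*} [AddCommGroup M] (A : Set M) : Submodule ℤ M where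
  carrier := {m | ∃ n : ℤ, 0 < n ∧ n • m ∈ Submodule.span ℤ A}
  zero_mem' := ⟨1, one_pos, by simp⟩
  add_mem' := by
    rintro a c ⟨n, hn, ha⟩ ⟨k, hk, hc⟩
    refine ⟨n * k, mul_pos hn hk, ?_⟩
    have h : (n * k) • (a + c) = k • (n • a) + n • (k • c) := by
      rw [smul_add, smul_smul, smul_smul, mul_comm k n]
    rw [h]
    exact Submodule.add_mem _ (Submodule.smul_mem _ _ ha) (Submodule.smul_mem _ _ hc)
  smul_mem' := by
    intro c m hm
    obtain ⟨n, hn, h⟩ := hm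
    refine ⟨n, hn, ?_⟩
    have hcomm : n • c • m = c • n • m := by rw [smul_smul, smul_smul, mul_comm]
    rw [hcomm]
    exact Submodule.smul_mem _ _ h

/-- Every orbit lies in a single coset of the coinvariant sublattice. -/
theorem map_sub_self_mem_coinvariantSublattice {M G : Type*} [AddCommGroup M] [Group G]
    (b : M →ₗ[ℤ] M →ₗ[ℤ] ℤ) (ρ : G →* M ≃ₗ[ℤ] M)
    (hiso : ∀ (g : G) (x y : M), b (ρ g x) (ρ g y) = b x y) (g : G) (a : M) :
    ρ g a - a ∈ coinvariantSublattice b ρ := by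
  intro x hx
  have h := hiso g a x
  rw [hx g] at h
  rw [map_sub, LinearMap.sub_apply, h, sub_self]

theorem primClosure_eq_of_span_eq {M : Type*} [AddCommGroup M] {A B : Set M}
    (h : Submodule.span ℤ A = Submodule.span ℤ B) : primClosure A = primClosure B := by
  ext m
  change (∃ n : ℤ, 0 < n ∧ n • m ∈ Submodule.span ℤ A) ↔
    ∃ n : ℤ, 0 < n ∧ n • m ∈ Submodule.span ℤ B
  rw [h]

/-- If `G ⊆ G'` act on the lattice `M` by isometries (the `G`-action being
the restriction of the `G'`-action) and the coinvariant sublattices coincide,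
`(M^G)^⊥ = (M^{G'})^⊥ = S`, then for all `α_1, …, α_t ∈ M` the primitive closures
`[S ∪ G·α_1 ∪ … ∪ G·α_t]_pr` and `[S ∪ G'·α_1 ∪ … ∪ G'·α_t]_pr` coincide. -/
theorem primClosure_orbits_eq_of_coinvariant_eq
    {M G' : Type*} [AddCommGroup M] [Module.Free ℤ M] [Module.Finite ℤ M] [Group G']
    (b : M →ₗ[ℤ] M →ₗ[ℤ] ℤ) (hsymm : ∀ x y : M, b x y = b y x)
    (ρ : G' →* M ≃ₗ[ℤ] M) (hiso : ∀ (g : G') (x y : M), b (ρ g x) (ρ g y) = b x y)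
    (G : Subgroup G')
    (hco : coinvariantSublattice b (ρ.comp G.subtype) = coinvariantSublattice b ρ)
    (t : ℕ) (α : Fin t → M) :
    primClosure
        ((coinvariantSublattice b ρ : Set M) ∪
          ⋃ i, Set.range fun g : G => ρ (g : G') (α i)) =
      primClosure
        ((coinvariantSublattice b ρ : Set M) ∪
          ⋃ i, Set.range fun g : G' => ρ g (α i)) := by
  apply primClosure_eq_of_span_eq
  apply le_antisymm
  · apply Submodule.span_mono
    apply Set.union_subset_union_right
    apply Set.iUnion_mono
    rintro i _ ⟨g, rfl⟩
    exact ⟨g, rfl⟩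
  · rw [Submodule.span_le]
    refine Set.union_subset (Set.subset_union_left.trans Submodule.subset_span)
      (Set.iUnion_subset ?_)
    rintro i _ ⟨g, rfl⟩
    have hα : α i ∈ ⋃ i, Set.range fun g : G => ρ (g : G') (α i) :=
      Set.mem_iUnion.2 ⟨i, 1, by simp⟩
    have hS := map_sub_self_mem_coinvariantSublattice b ρ hiso g (α i)
    change ρ g (α i) ∈ Submodule.span ℤ _
    rw [← sub_add_cancel (ρ g (α i)) (α i)]
    exact Submodule.add_mem _ (Submodule.subset_span (Set.mem_union_left _ hS))
      (Submodule.subset_span (Set.mem_union_right _ hα))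
end

section
/- Let M be a lattice, G a group acting on M by isometries, and S_G = (M^G)^⊥ the coinvariant sublattice. Assume S_G contains no element v with b(v, v) = −2, let α ∈ M satisfy b(α, α) = −2, and set S = [S_G ∪ {α}]_pr. Then: (1) S_G is a primitive sublattice of S of corank 1 (S/S_G is torsion-free of rank 1); (2) S_G = {s ∈ S : b(s, x) = 0 for all x ∈ M^G}, i.e. S_G = S ∩ (M^G)^⊥; and (3) S is G-invariant: g·S = S for every g ∈ G. -/
theorem mem_primClosure_union_singleton {M : Type*} [AddCommGroup M]
    (N : Submodule ℤ M) (α m : M) :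
    m ∈ primClosure ((N : Set M) ∪ {α}) ↔
      ∃ n : ℤ, 0 < n ∧ ∃ y ∈ N, ∃ k : ℤ, n • m = y + k • α := by
  change (∃ n : ℤ, 0 < n ∧ n • m ∈ Submodule.span ℤ ((N : Set M) ∪ {α})) ↔ _
  simp only [Submodule.span_union, Submodule.span_eq, Submodule.mem_sup,
    Submodule.mem_span_singleton]
  constructor
  · rintro ⟨n, hn, y, hy, _, ⟨k, rfl⟩, h⟩
    exact ⟨n, hn, y, hy, k, h.symm⟩
  · rintro ⟨n, hn, y, hy, k, h⟩
    exact ⟨n, hn, y, hy, _, ⟨k, rfl⟩, h.symm⟩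

theorem subset_primClosure {M : Type*} [AddCommGroup M] (A : Set M) :
    A ⊆ primClosure A :=
  fun a ha => ⟨1, one_pos, by simpa using Submodule.subset_span ha⟩

theorem mem_coinvariantSublattice_of_smul_mem {M G : Type*} [AddCommGroup M] [Group G]
    {b : M →ₗ[ℤ] M →ₗ[ℤ] ℤ} {ρ : G →* M ≃ₗ[ℤ] M} {n : ℤ} (hn : n ≠ 0) {s : M}
    (h : n • s ∈ coinvariantSublattice b ρ) : s ∈ coinvariantSublattice b ρ := by
  intro x hx
  have hnx := h x hx
  rw [map_smul, LinearMap.smul_apply, smul_eq_mul] at hnx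
  exact (mul_eq_zero.mp hnx).resolve_left hn

theorem apply_sub_self_mem_coinvariantSublattice {M G : Type*} [AddCommGroup M] [Group G]
    {b : M →ₗ[ℤ] M →ₗ[ℤ] ℤ} {ρ : G →* M ≃ₗ[ℤ] M}
    (hiso : ∀ (g : G) (x y : M), b (ρ g x) (ρ g y) = b x y) (g : G) (m : M) :
    ρ g m - m ∈ coinvariantSublattice b ρ := by
  intro x hx
  have h := hiso g m x
  rw [hx g] at h
  rw [map_sub, LinearMap.sub_apply, h, sub_self]

/-- Any sublattice containing the coinvariant sublattice is `G`-invariant. -/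
theorem map_eq_of_coinvariantSublattice_le {M G : Type*} [AddCommGroup M] [Group G]
    {b : M →ₗ[ℤ] M →ₗ[ℤ] ℤ} {ρ : G →* M ≃ₗ[ℤ] M}
    (hiso : ∀ (g : G) (x y : M), b (ρ g x) (ρ g y) = b x y) {S : Submodule ℤ M}
    (hS : coinvariantSublattice b ρ ≤ S) (g : G) :
    Submodule.map (ρ g : M →ₗ[ℤ] M) S = S := by
  have hmem (h : G) {s : M} (hs : s ∈ S) : ρ h s ∈ S := by
    simpa using S.add_mem (hS (apply_sub_self_mem_coinvariantSublattice hiso h s)) hs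
  apply le_antisymm
  · rintro _ ⟨s, hs, rfl⟩
    exact hmem g hs
  · intro s hs
    refine ⟨ρ g⁻¹ s, hmem g⁻¹ hs, ?_⟩
    change (ρ g * ρ g⁻¹) s = s
    rw [← map_mul, mul_inv_cancel, map_one, LinearEquiv.coe_one, id_eq]

theorem finrank_primClosure_coinvariantSublattice {M G : Type*} [AddCommGroup M]
    [Module.Free ℤ M] [Module.Finite ℤ M] [Group G]
    {b : M →ₗ[ℤ] M →ₗ[ℤ] ℤ} {ρ : G →* M ≃ₗ[ℤ] M} {α : M}
    (hα : α ∉ coinvariantSublattice b ρ) :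
    Module.finrank ℤ (primClosure ((coinvariantSublattice b ρ : Set M) ∪ {α})) =
      Module.finrank ℤ (coinvariantSublattice b ρ) + 1 := by
  obtain ⟨x, hx, hαx⟩ : ∃ x ∈ invariantSublattice ρ, b α x ≠ 0 := by
    by_contra! h
    exact hα h
  set N := coinvariantSublattice b ρ
  set S := primClosure ((N : Set M) ∪ {α})
  have hNS : N ≤ S := fun y hy => subset_primClosure _ (Or.inl hy)
  have hαS : α ∈ S := subset_primClosure _ (Or.inr rfl)
  let φ : S →ₗ[ℤ] ℤ := (b.flip x).comp S.subtype
  have hker : LinearMap.ker φ = N.submoduleOf S := by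
    ext ⟨s, hs⟩
    change b s x = 0 ↔ s ∈ N
    refine ⟨fun hsx => ?_, fun hsN => hsN x hx⟩
    obtain ⟨n, hn, y, hy, k, h⟩ := (mem_primClosure_union_singleton N α s).mp hs
    have hk : k * b α x = 0 := by
      simpa [hsx, hy x hx] using (congrArg (fun z => b z x) h).symm
    refine mem_coinvariantSublattice_of_smul_mem hn.ne' ?_
    rw [h, (mul_eq_zero.mp hk).resolve_right hαx, zero_smul, add_zero]
    exact hy
  have hrange : Module.finrank ℤ (LinearMap.range φ) = 1 := by
    apply le_antisymm
    · simpa using Submodule.finrank_le (LinearMap.range φ)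
    · rw [Submodule.one_le_finrank_iff, Submodule.ne_bot_iff]
      exact ⟨_, ⟨⟨α, hαS⟩, rfl⟩, hαx⟩
  have h := Submodule.finrank_quotient_add_finrank (LinearMap.ker φ)
  rw [φ.quotKerEquivRange.finrank_eq, hrange, hker, (Submodule.submoduleOfEquivOfLe hNS).finrank_eq, add_comm] at h
  exact h.symm

/-- Suppose `S_G = (M^G)^⊥` has no vector of square `-2`, `α ∈ M` has
`b α α = -2`, and `S = [S_G ∪ {α}]_pr`. Then (1) `S_G` is a primitive sublattice of `S`
of corank 1 (`S/S_G` is torsion-free of rank 1, i.e. `S_G ≤ S`, the quotient has no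
torsion, and `rk S = rk S_G + 1`); (2) `S_G = S ∩ (M^G)^⊥`, i.e. `S_G` consists exactly
of the elements of `S` orthogonal to `M^G`; and (3) `S` is `G`-invariant. -/
theorem primClosure_coinvariant_structure
    {M G : Type*} [AddCommGroup M] [Module.Free ℤ M] [Module.Finite ℤ M] [Group G]
    (b : M →ₗ[ℤ] M →ₗ[ℤ] ℤ) (hsymm : ∀ x y : M, b x y = b y x)
    (ρ : G →* M ≃ₗ[ℤ] M) (hiso : ∀ (g : G) (x y : M), b (ρ g x) (ρ g y) = b x y)
    (hroot : ∀ v ∈ coinvariantSublattice b ρ, b v v ≠ -2)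
    (α : M) (hα : b α α = -2)
    (S : Submodule ℤ M)
    (hS : S = primClosure ((coinvariantSublattice b ρ : Set M) ∪ {α})) :
    coinvariantSublattice b ρ ≤ S ∧
    (∀ s ∈ S, ∀ n : ℤ, n ≠ 0 →
      n • s ∈ coinvariantSublattice b ρ → s ∈ coinvariantSublattice b ρ) ∧
    Module.finrank ℤ ↥S = Module.finrank ℤ ↥(coinvariantSublattice b ρ) + 1 ∧
    ((S : Set M) ∩ {y : M | ∀ x ∈ invariantSublattice ρ, b y x = 0}) =
      (coinvariantSublattice b ρ : Set M) ∧
    (∀ g : G, Submodule.map (ρ g : M →ₗ[ℤ] M) S = S) := by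
  subst hS
  have hle : coinvariantSublattice b ρ ≤
      primClosure ((coinvariantSublattice b ρ : Set M) ∪ {α}) :=
    fun y hy => subset_primClosure _ (Or.inl hy)
  refine ⟨hle, fun s _ n hn => mem_coinvariantSublattice_of_smul_mem hn,
    finrank_primClosure_coinvariantSublattice fun h => hroot α h hα, ?_,
    map_eq_of_coinvariantSublattice_le hiso hle⟩
  exact Set.inter_eq_right.mpr hle
end
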